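/- arXiv:1312.2727 — 3 statements merged into one kernel-verified Lean document; each statement's English description precedes it below -/
import Mathlib

section
/- For any two compositions I and J whose last parts are greater than 1, the product of the corresponding elements of Sol′ satisfies H_I · H_J = Σ_{K ∈ I⧢J} H_K, where I⧢J is the multiset of shuffles of the sequences of parts of I and J. -/
open MvPolynomial

/-- Sequences of polynomials: the `n`-th term is thought of as a polynomial in
`x_1, …, x_n` (variable `j : ℕ` corresponds to `x_{j+1}`). -/
abbrev PolySeq : Type := (n : ℕ) → MvPolynomial ℕ ℂ

/-- The algebra morphism substituting `0` for the variable `x_{n+1}` (index `n`). -/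
noncomputable def killVar (n : ℕ) : MvPolynomial ℕ ℂ →ₐ[ℂ] MvPolynomial ℕ ℂ :=
  aeval (fun j => if j = n then 0 else X j)

/-- `f` is a *stable polynomial*: `f n` only involves `x_1, …, x_n` and setting the last
variable of `f (n+1)` to zero gives back `f n`. -/
def IsStable (f : PolySeq) : Prop :=
  (∀ n, f n ∈ supported ℂ (Set.Iio n)) ∧ ∀ n, killVar n (f (n + 1)) = f n

/-- The substitution `x_{j+2} := x_{j+1}` (0-based : variable `j+1` is replaced by variable `j`). -/
noncomputable def collapse (j : ℕ) : MvPolynomial ℕ ℂ →ₐ[ℂ] MvPolynomial ℕ ℂ :=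
  aeval (fun k => if k = j + 1 then X j else X k)

/-- Renaming of variables skipping the two indices `j`, `j+1`. -/
noncomputable def skip2 (j : ℕ) : MvPolynomial ℕ ℂ →ₐ[ℂ] MvPolynomial ℕ ℂ :=
  rename (fun k => if k < j then k else k + 2)

/-- The functional equation (1) of the paper: substituting `x_{i+1} = x_i` in `f_n` yields
`f_{n-2} (x_1, …, x_{i-1}, x_{i+2}, …, x_n)`. -/
def IsSol (f : PolySeq) : Prop :=
  IsStable f ∧ ∀ n j : ℕ, j + 2 ≤ n → collapse j (f n) = skip2 j (f (n - 2))

/-- Homogeneity of degree `d` for a stable polynomial. -/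
def IsHomogSeq (f : PolySeq) (d : ℕ) : Prop := ∀ n, (f n).IsHomogeneous d

private lemma homog_smul {p : MvPolynomial ℕ ℂ} {d : ℕ} (c : ℂ) (h : p.IsHomogeneous d) :
    (c • p).IsHomogeneous d := by
  rw [smul_eq_C_mul]
  simpa using (isHomogeneous_C ℕ c).mul h

/-- The homogeneous component of degree `d` of the space of solutions of the
functional equation, as a `ℂ`-vector space. -/
noncomputable def SolHomog (d : ℕ) : Submodule ℂ PolySeq where
  carrier := {f | IsSol f ∧ IsHomogSeq f d}
  zero_mem' := by
    refine ⟨⟨⟨fun n => Subalgebra.zero_mem _, fun n => by simp only [Pi.zero_apply, map_zero]⟩,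
      fun n j _ => by simp only [Pi.zero_apply, map_zero]⟩, fun n => isHomogeneous_zero _ _ _⟩
  add_mem' := by
    rintro a b ⟨⟨⟨ha1, ha2⟩, ha3⟩, ha4⟩ ⟨⟨⟨hb1, hb2⟩, hb3⟩, hb4⟩
    refine ⟨⟨⟨fun n => Subalgebra.add_mem _ (ha1 n) (hb1 n), fun n => ?_⟩, fun n j h => ?_⟩,
      fun n => (ha4 n).add (hb4 n)⟩
    · simp only [Pi.add_apply, map_add, ha2 n, hb2 n]
    · simp only [Pi.add_apply, map_add, ha3 n j h, hb3 n j h]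
  smul_mem' := by
    rintro c a ⟨⟨⟨ha1, ha2⟩, ha3⟩, ha4⟩
    refine ⟨⟨⟨fun n => Subalgebra.smul_mem _ (ha1 n) c, fun n => ?_⟩, fun n j h => ?_⟩,
      fun n => homog_smul c (ha4 n)⟩
    · simp only [Pi.smul_apply, map_smul, ha2 n]
    · simp only [Pi.smul_apply, map_smul, ha3 n j h]

/-- Polynomials in the two families of (commuting) variables `p_1, p_2, …` (`Sum.inl`, 0-based)
and `q_1, q_2, …` (`Sum.inr`, 0-based). -/
abbrev PQPoly : Type := MvPolynomial (ℕ ⊕ ℕ) ℂ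

/-- Sequences of polynomials, the `m`-th term being thought of as a polynomial in
`p_1, …, p_m, q_1, …, q_m`. -/
abbrev PQSeq : Type := (m : ℕ) → PQPoly

/-- The variables `p_1, …, p_m, q_1, …, q_m`. -/
def pqVars (m : ℕ) : Set (ℕ ⊕ ℕ) := Sum.inl '' Set.Iio m ∪ Sum.inr '' Set.Iio m

/-- Substituting `0` for both `p_{m+1}` and `q_{m+1}` (0-based index `m`). -/
noncomputable def killPQ (m : ℕ) : PQPoly →ₐ[ℂ] PQPoly :=
  aeval (Sum.elim (fun k => if k = m then 0 else X (Sum.inl k))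
    (fun k => if k = m then 0 else X (Sum.inr k)))

/-- `h` is a two-alphabet stable polynomial. -/
def IsStablePQ (h : PQSeq) : Prop :=
  (∀ m, h m ∈ supported ℂ (pqVars m)) ∧ ∀ m, killPQ m (h (m + 1)) = h m

/-- Substituting `0` for the variable `v0`. -/
noncomputable def subst0PQ (v0 : ℕ ⊕ ℕ) : PQPoly →ₐ[ℂ] PQPoly :=
  aeval (fun v => if v = v0 then 0 else X v)

/-- The substitution describing the right-hand side of equation (EqQZero) : the parts
`p_{j+1}` and `p_{j+2}` are merged (`0`-based : `p_j`, `p_{j+1}`) and `q_{j+1}` is removed. -/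
noncomputable def mergeP (j : ℕ) : PQPoly →ₐ[ℂ] PQPoly :=
  aeval (Sum.elim
    (fun k => if k < j then X (Sum.inl k)
      else if k = j then X (Sum.inl j) + X (Sum.inl (j + 1)) else X (Sum.inl (k + 1)))
    (fun k => if k < j then X (Sum.inr k) else X (Sum.inr (k + 1))))

/-- The substitution describing the right-hand side of equation (EqPZero) : `p_{j+1}`
(0-based `p_j`, `1 ≤ j`) is removed and the parts `q_{j-1}`, `q_j` (0-based) are merged. -/
noncomputable def mergeQ (j : ℕ) : PQPoly →ₐ[ℂ] PQPoly :=
  aeval (Sum.elim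
    (fun k => if k < j then X (Sum.inl k) else X (Sum.inl (k + 1)))
    (fun k => if k + 1 < j then X (Sum.inr k)
      else if k + 1 = j then X (Sum.inr k) + X (Sum.inr (k + 1)) else X (Sum.inr (k + 1))))

/-- The shift substitution, for the case `p_1 = 0` of equation (EqPZero). -/
noncomputable def shiftPQ : PQPoly →ₐ[ℂ] PQPoly :=
  aeval (Sum.elim (fun k => X (Sum.inl (k + 1))) (fun k => X (Sum.inr (k + 1))))

/-- The system of equations (EqQZero)-(EqPZero) defining `Sol'`: a two alphabet stable
polynomial whose components take the same values on any two multirectangular descriptions of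
a Young diagram. -/
def IsSolPQ (h : PQSeq) : Prop :=
  IsStablePQ h ∧
  (∀ m j, j + 2 ≤ m → subst0PQ (Sum.inr j) (h m) = mergeP j (h (m - 1))) ∧
  (∀ m, 1 ≤ m → subst0PQ (Sum.inr (m - 1)) (h m) = h (m - 1)) ∧
  (∀ m j, 1 ≤ j → j + 1 ≤ m → subst0PQ (Sum.inl j) (h m) = mergeQ j (h (m - 1))) ∧
  (∀ m, 1 ≤ m → subst0PQ (Sum.inl 0) (h m) = shiftPQ (h (m - 1)))

/-- The polynomial expression of the interlacing coordinate `x_{t+1}` (0-based index `t`)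
in terms of multirectangular coordinates:
`x_{2i+1} = (q_{i+1} + … + q_m) - (p_1 + … + p_i)` and
`x_{2i} = (q_i + … + q_m) - (p_1 + … + p_i)`. -/
noncomputable def xExpr (m t : ℕ) : PQPoly :=
  (∑ k ∈ Finset.Ico (if t % 2 = 0 then (t + 1) / 2 else (t + 1) / 2 - 1) m, X (Sum.inr k))
    - ∑ k ∈ Finset.range ((t + 1) / 2), X (Sum.inl k)

/-- The change of variables `Φ_{x → p,q}` from interlacing to multirectangular coordinates. -/
noncomputable def PhiXtoPQ (f : PolySeq) : PQSeq :=
  fun m => aeval (xExpr m) (f (2 * m + 1))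

/-- The multirectangular coordinates in terms of interlacing coordinates:
`p_i = x_{2i-1} - x_{2i}` and `q_i = x_{2i} - x_{2i+1}` (all 0-based here). -/
noncomputable def pqExpr : (ℕ ⊕ ℕ) → MvPolynomial ℕ ℂ :=
  Sum.elim (fun k => X (2 * k) - X (2 * k + 1)) (fun k => X (2 * k + 1) - X (2 * k + 2))

/-- The change of variables `Φ_{p,q → x}` from multirectangular to interlacing coordinates. -/
noncomputable def PhiPQtoX (h : PQSeq) : PolySeq :=
  fun n => if n % 2 = 1 then aeval pqExpr (h (n / 2))
    else killVar n (aeval pqExpr (h (n / 2)))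

/-- All the ways of writing a list as a concatenation of nonempty blocks. -/
def splits {α : Type} : List α → List (List (List α))
  | [] => [[]]
  | a :: l =>
    (splits l).flatMap (fun LL =>
      match LL with
      | [] => [[[a]]]
      | B :: rest => [[a] :: B :: rest, (a :: B) :: rest])

/-- The variable `q'_{k+1} = q_{k+1} + … + q_m` (`0`-based index `k`). -/
noncomputable def qprime (m k : ℕ) : PQPoly := ∑ j ∈ Finset.Ico k m, X (Sum.inr j)

/-- The summand `p_k^{ℓ(B)} (q'_k)^{|B| - ℓ(B)} / ℓ(B)!` of `H_I` attached to a block `B`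
placed at (0-based) position `k`. -/
noncomputable def Hterm (m : ℕ) (B : List ℕ) (k : ℕ) : PQPoly :=
  C ((B.length.factorial : ℂ))⁻¹ * (X (Sum.inl k)) ^ B.length *
    (qprime m k) ^ (B.sum - B.length)

/-- The two-alphabet stable polynomial `H_I` attached to a composition `I`. -/
noncomputable def HI (I : List ℕ) : PQSeq :=
  fun m =>
    ((splits I).map (fun LL =>
      ∑ K ∈ Finset.powersetCard LL.length (Finset.range m),
        ((LL.zip (K.sort (· ≤ ·))).map (fun Bk => Hterm m Bk.1 Bk.2)).prod)).sum

/-- The multiset of shuffles of two lists. -/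
def shuffles : List ℕ → List ℕ → Multiset (List ℕ)
  | [], J => {J}
  | I, [] => {I}
  | a :: I, b :: J =>
      ((shuffles I (b :: J)).map (a :: ·)) + ((shuffles (a :: I) J).map (b :: ·))
termination_by I J => I.length + J.length

section Deconcatenation

variable {α : Type} {R : Type*}

/-- The multiset of all pairs `(l₁, l₂)` with `l₁ ++ l₂ = l`. -/
def deconcat : List α → Multiset (List α × List α)
  | [] => {([], [])}
  | a :: l => ([], a :: l) ::ₘ (deconcat l).map (fun p => (a :: p.1, p.2))

lemma append_eq_of_mem_deconcat {l : List α} {p : List α × List α} (hp : p ∈ deconcat l) :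
    p.1 ++ p.2 = l := by
  induction l generalizing p with
  | nil => simp_all [deconcat]
  | cons a l ih =>
    simp only [deconcat, Multiset.mem_cons, Multiset.mem_map] at hp
    rcases hp with rfl | ⟨q, hq, rfl⟩
    · rfl
    · simp [ih hq]

lemma sum_deconcat_cons [AddCommMonoid R] (a : α) (l : List α) (f : List α × List α → R) :
    ((deconcat (a :: l)).map f).sum =
      f ([], a :: l) + ((deconcat l).map (fun p => f (a :: p.1, p.2))).sum := by
  simp [deconcat, Multiset.map_map]

/-- Splitting a nonempty list into blocks amounts to choosing the first block and splitting the
remaining suffix. -/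
lemma sum_splits_cons [AddCommMonoid R] (a : α) (l : List α) (g : List (List α) → R) :
    ((splits (a :: l)).map g).sum =
      ((deconcat l).map (fun p =>
        ((splits p.2).map (fun LL => g ((a :: p.1) :: LL))).sum)).sum := by
  induction l generalizing a g with
  | nil => simp [splits, deconcat]
  | cons b l ih =>
    have key : ∀ L : List (List (List α)), (∀ LL ∈ L, LL ≠ []) →
        ((L.flatMap (fun LL => match LL with
          | [] => [[[a]]]
          | B :: rest => [[a] :: B :: rest, (a :: B) :: rest])).map g).sum =
        (L.map (fun LL => g ([a] :: LL))).sum +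
          (L.map (fun LL => g ((a :: LL.headD []) :: LL.tail))).sum := by
      intro L hL
      induction L with
      | nil => simp
      | cons LL L ihL =>
        obtain ⟨B, rest, rfl⟩ := List.exists_cons_of_ne_nil (hL LL (by simp))
        have := ihL (fun M hM => hL M (by simp [hM]))
        simp only [List.flatMap_cons, List.map_append, List.sum_append, this]
        simp only [List.map_cons, List.map_nil, List.sum_cons, List.sum_nil, List.headD_cons,
          List.tail_cons]
        abel
    have hne : ∀ LL ∈ splits (b :: l), LL ≠ [] := by
      intro LL hLL
      simp only [splits, List.mem_flatMap] at hLL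
      obtain ⟨M, -, hM⟩ := hLL
      cases M <;> aesop
    rw [splits, key _ hne, sum_deconcat_cons, ih b (fun LL => g ((a :: LL.headD []) :: LL.tail))]
    simp

end Deconcatenation

section Shuffle

variable {R : Type*}

lemma shuffles_nil_left (J : List ℕ) : shuffles [] J = {J} := by
  simp [shuffles]

lemma shuffles_nil_right (I : List ℕ) : shuffles I [] = {I} := by
  cases I <;> simp [shuffles]

lemma sum_shuffles_cons_cons [AddCommMonoid R] (a b : ℕ) (I J : List ℕ) (f : List ℕ → R) :
    ((shuffles (a :: I) (b :: J)).map f).sum =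
      ((shuffles I (b :: J)).map (fun K => f (a :: K))).sum +
        ((shuffles (a :: I) J).map (fun K => f (b :: K))).sum := by
  simp [shuffles, Multiset.map_map]

lemma perm_append_of_mem_shuffles (I J : List ℕ) {K : List ℕ} (hK : K ∈ shuffles I J) :
    K.Perm (I ++ J) := by
  fun_induction shuffles I J generalizing K with
  | case1 J => simp_all
  | case2 I h => simp_all
  | case3 a I b J ih1 ih2 =>
    simp only [Multiset.mem_add, Multiset.mem_map] at hK
    rcases hK with ⟨L, hL, rfl⟩ | ⟨L, hL, rfl⟩
    · exact (ih1 hL).cons a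
    · exact ((ih2 hL).cons b).trans List.perm_middle.symm

lemma card_shuffles (I J : List ℕ) :
    (shuffles I J).card = (I.length + J.length).choose I.length := by
  fun_induction shuffles I J with
  | case1 J => simp
  | case2 I h => simp
  | case3 a I b J ih1 ih2 =>
    simp only [Multiset.card_add, Multiset.card_map, ih1, ih2, List.length_cons]
    rw [show I.length + 1 + (J.length + 1) = (I.length + (J.length + 1)) + 1 by ring,
      Nat.choose_succ_succ, show I.length + 1 + J.length = I.length + (J.length + 1) by ring]

/-- Deconcatenation is compatible with shuffles. -/
lemma sum_shuffles_deconcat [AddCommMonoid R] (I J : List ℕ) (f : List ℕ → List ℕ → R) :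
    ((shuffles I J).map (fun K => ((deconcat K).map (fun p => f p.1 p.2)).sum)).sum =
      ((deconcat I).map (fun p => ((deconcat J).map (fun q =>
        ((shuffles p.1 q.1).map (fun K₁ =>
          ((shuffles p.2 q.2).map (fun K₂ => f K₁ K₂)).sum)).sum)).sum)).sum := by
  fun_induction shuffles I J generalizing f with
  | case1 J => simp [deconcat, shuffles_nil_left]
  | case2 I h => simp [deconcat, shuffles_nil_right]
  | case3 a I b J ih1 ih2 =>
    simp only [Multiset.map_add, Multiset.sum_add, Multiset.map_map, Function.comp_def,
      sum_deconcat_cons, Multiset.sum_map_add, ih1 (fun x y => f (a :: x) y),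
      ih2 (fun x y => f (b :: x) y), sum_shuffles_cons_cons, shuffles_nil_left,
      shuffles_nil_right, Multiset.map_singleton, Multiset.sum_singleton]
    abel

/-- `φ` turns shuffle products of words with positive letters into products. -/
def IsShuffleCharacter [CommSemiring R] (φ : List ℕ → R) : Prop :=
  ∀ I J : List ℕ, (∀ c ∈ I, 0 < c) → (∀ c ∈ J, 0 < c) →
    φ I * φ J = ((shuffles I J).map φ).sum

/-- The convolution of two functions on words with respect to deconcatenation. -/
def convolution [CommSemiring R] (φ ψ : List ℕ → R) (I : List ℕ) : R :=
  ((deconcat I).map (fun p => φ p.1 * ψ p.2)).sum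

lemma IsShuffleCharacter.convolution [CommSemiring R] {φ ψ : List ℕ → R}
    (hφ : IsShuffleCharacter φ) (hψ : IsShuffleCharacter ψ) :
    IsShuffleCharacter (convolution φ ψ) := by
  intro I J hI hJ
  unfold _root_.convolution
  rw [sum_shuffles_deconcat I J (fun x y => φ x * ψ y), ← Multiset.sum_map_mul_right]
  refine congrArg Multiset.sum (Multiset.map_congr rfl fun p hp => ?_)
  rw [← Multiset.sum_map_mul_left]
  refine congrArg Multiset.sum (Multiset.map_congr rfl fun q hq => ?_)
  have hp' := append_eq_of_mem_deconcat hp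
  have hq' := append_eq_of_mem_deconcat hq
  subst hp' hq'
  simp only [List.mem_append] at hI hJ
  simp only [Multiset.sum_map_mul_left, Multiset.sum_map_mul_right]
  rw [← hφ p.1 q.1 (fun c hc => hI c (.inl hc)) (fun c hc => hJ c (.inl hc)),
    ← hψ p.2 q.2 (fun c hc => hI c (.inr hc)) (fun c hc => hJ c (.inr hc))]
  ring

end Shuffle

section BlockSum

variable {R : Type*} [CommSemiring R]

/-- The sum, over all ways of attaching the blocks of a list to increasing positions taken from
a list of positions, of the products of the weights `h B k`. -/
def placementSum (h : List ℕ → ℕ → R) : List (List ℕ) → List ℕ → R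
  | [], _ => 1
  | _ :: _, [] => 0
  | B :: LL, k :: ks => placementSum h (B :: LL) ks + h B k * placementSum h LL ks

lemma sum_powersetCard_prod_zip_sort (h : List ℕ → ℕ → R) (LL : List (List ℕ)) (ks : List ℕ)
    (hks : ks.Pairwise (· < ·)) :
    ∑ K ∈ Finset.powersetCard LL.length ks.toFinset,
      ((LL.zip (K.sort (· ≤ ·))).map (fun Bk => h Bk.1 Bk.2)).prod = placementSum h LL ks := by
  induction ks generalizing LL with
  | nil =>
    cases LL with
    | nil => simp [placementSum]
    | cons B LL =>
      rw [Finset.powersetCard_eq_empty.2 (by simp)]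
      simp [placementSum]
  | cons k ks ih =>
    cases LL with
    | nil => simp [placementSum]
    | cons B LL =>
      rw [List.pairwise_cons] at hks
      have hk : k ∉ ks.toFinset := fun hmem => (hks.1 k (List.mem_toFinset.1 hmem)).false
      rw [List.toFinset_cons, List.length_cons, Finset.powersetCard_succ_insert hk,
        Finset.sum_union, Nat.succ_eq_add_one, ← List.length_cons (a := B), ih _ hks.2,
        Finset.sum_image, placementSum, ← ih LL hks.2, Finset.mul_sum]
      · congr 1
        refine Finset.sum_congr rfl fun K hK => ?_
        have hsub := (Finset.mem_powersetCard.1 hK).1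
        rw [Finset.sort_insert _ (fun b hb => (hks.1 b (List.mem_toFinset.1 (hsub hb))).le)
          (fun hmem => hk (hsub hmem))]
        simp
      · intro K hK L hL hKL
        have hK' := fun hmem => hk ((Finset.mem_powersetCard.1 hK).1 hmem)
        have hL' := fun hmem => hk ((Finset.mem_powersetCard.1 hL).1 hmem)
        rw [← Finset.erase_insert hK', ← Finset.erase_insert hL', hKL]
      · rw [Finset.disjoint_left]
        intro K hK hK'
        obtain ⟨L, -, rfl⟩ := Finset.mem_image.1 hK'
        exact hk ((Finset.mem_powersetCard.1 hK).1 (Finset.mem_insert_self k L))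

/-- The sum of `placementSum` over all ways of cutting a word into nonempty blocks. -/
def blockSum (h : List ℕ → ℕ → R) (ks : List ℕ) (I : List ℕ) : R :=
  ((splits I).map (fun LL => placementSum h LL ks)).sum

lemma blockSum_cons (h : List ℕ → ℕ → R) (k : ℕ) (hk : h [] k = 1) (ks : List ℕ) :
    blockSum h (k :: ks) = convolution (fun B => h B k) (blockSum h ks) := by
  funext I
  cases I with
  | nil => simp [blockSum, convolution, splits, deconcat, placementSum, hk]
  | cons a I =>
    rw [convolution, sum_deconcat_cons, hk, one_mul]
    simp only [blockSum]
    rw [sum_splits_cons, sum_splits_cons]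
    simp only [placementSum, List.sum_map_add, Multiset.sum_map_add, List.sum_map_mul_left]

lemma isShuffleCharacter_blockSum_nil (h : List ℕ → ℕ → R) :
    IsShuffleCharacter (blockSum h []) := by
  have hnil : blockSum h [] [] = 1 := by simp [blockSum, splits, placementSum]
  have hcons : ∀ a I, blockSum h [] (a :: I) = 0 := by
    intro a I
    simp [blockSum, sum_splits_cons, placementSum]
  rintro (_ | ⟨a, I⟩) (_ | ⟨b, J⟩) - -
  · simp [shuffles_nil_left, hnil]
  · simp [shuffles_nil_left, hnil]
  · simp [shuffles_nil_right, hnil]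
  · simp [sum_shuffles_cons_cons, hcons]

lemma isShuffleCharacter_blockSum (h : List ℕ → ℕ → R) (hnil : ∀ k, h [] k = 1)
    (hchar : ∀ k, IsShuffleCharacter (fun B => h B k)) (ks : List ℕ) :
    IsShuffleCharacter (blockSum h ks) := by
  induction ks with
  | nil => exact isShuffleCharacter_blockSum_nil h
  | cons k ks ih =>
    rw [blockSum_cons h k (hnil k)]
    exact (hchar k).convolution ih

end BlockSum

lemma isShuffleCharacter_Hterm (m k : ℕ) : IsShuffleCharacter (fun B => Hterm m B k) := by
  intro I J hI hJ
  have hle : ∀ L : List ℕ, (∀ c ∈ L, 0 < c) → L.length ≤ L.sum := fun L hL => by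
    simpa using List.card_nsmul_le_sum L 1 hL
  have hconst : ∀ K ∈ shuffles I J, Hterm m K k =
      C (((I.length + J.length).factorial : ℂ))⁻¹ * X (Sum.inl k) ^ (I.length + J.length) *
        qprime m k ^ ((I.sum - I.length) + (J.sum - J.length)) := by
    intro K hK
    have hperm := perm_append_of_mem_shuffles I J hK
    have hsum : K.sum - (I.length + J.length) =
        (I.sum - I.length) + (J.sum - J.length) := by
      rw [hperm.sum_eq, List.sum_append]
      have := hle I hI
      have := hle J hJ
      omega
    have hlen : K.length = I.length + J.length := by
      rw [hperm.length_eq, List.length_append]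
    rw [Hterm, hlen, hsum]
  rw [Multiset.map_congr rfl hconst, Multiset.map_const', Multiset.sum_replicate,
    card_shuffles, nsmul_eq_mul]
  have hcoef : (((I.length + J.length).choose I.length : ℕ) : PQPoly) *
      C (((I.length + J.length).factorial : ℂ))⁻¹ =
      C ((I.length.factorial : ℂ))⁻¹ * C ((J.length.factorial : ℂ))⁻¹ := by
    rw [← map_natCast (C : ℂ →+* PQPoly), ← C_mul, ← C_mul, Nat.cast_add_choose]
    congr 1
    have := Nat.cast_ne_zero (R := ℂ).2 (I.length + J.length).factorial_ne_zero
    field_simp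
  simp only [Hterm]
  linear_combination (-X (Sum.inl k) ^ (I.length + J.length) *
    qprime m k ^ ((I.sum - I.length) + (J.sum - J.length))) * hcoef

lemma HI_apply_eq_blockSum (I : List ℕ) (m : ℕ) :
    HI I m = blockSum (Hterm m) (List.range m) I := by
  simp only [HI, blockSum]
  congr 1
  refine List.map_congr_left fun LL _ => ?_
  rw [← sum_powersetCard_prod_zip_sort _ _ _ List.pairwise_lt_range, List.toFinset_range]

/-- For compositions `I`, `J` whose last parts are greater than `1`,
`H_I · H_J = ∑_{K ∈ I ⧢ J} H_K`, where `I ⧢ J` is the multiset of shuffles of the parts. -/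
theorem HI_mul_HI_eq_shuffle_sum (I J : List ℕ) (hI : ∀ c ∈ I, 0 < c) (hJ : ∀ c ∈ J, 0 < c)
    (hIlast : ∀ h : I ≠ [], 1 < I.getLast h) (hJlast : ∀ h : J ≠ [], 1 < J.getLast h) :
    HI I * HI J = ((shuffles I J).map HI).sum := by
  funext m
  have hsum : ((shuffles I J).map HI).sum m =
      ((shuffles I J).map (fun K => blockSum (Hterm m) (List.range m) K)).sum := by
    refine (map_multiset_sum (Pi.evalAddMonoidHom (fun _ => PQPoly) m) _).trans ?_
    rw [Multiset.map_map]
    exact congrArg Multiset.sum (Multiset.map_congr rfl fun K _ => HI_apply_eq_blockSum K m)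
  rw [hsum, Pi.mul_apply, HI_apply_eq_blockSum, HI_apply_eq_blockSum]
  exact isShuffleCharacter_blockSum (Hterm m) (fun k => by simp [Hterm])
    (isShuffleCharacter_Hterm m) (List.range m) I J hI hJ
end

section
/- For every integer k ≥ 2, the image under Φ_{x→p,q} of the stable polynomial M_k(𝕏) (whose n-th component is Σ_{j=1}^n (−1)^j x_j^k) equals Σ_{i=0}^{k−2} (−1)^{i+1} (k!/(k−i−1)!) · H_{(1^i, k−i)}, where (1^i, k−i) denotes the composition with i parts equal to 1 followed by a part k−i, and k!/(k−i−1)! = k(k−1)⋯(k−i) is the falling factorial with i+1 factors. -/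
open MvPolynomial

/-- The stable polynomial `M_k(𝕏)`, whose `n`-th component is `∑_{j=1}^n (-1)^j x_j^k`. -/
noncomputable def MkX (k : ℕ) : PolySeq :=
  fun n => ∑ t ∈ Finset.range n, ((-1 : ℂ)) ^ (t + 1) • (X t) ^ k

/-- The sum, over all increasing assignments of the blocks of `LL` to elements of `S`, of the
products of the weights `w`. -/
noncomputable def chainSum {α : Type} {R : Type*} [CommRing R] (w : List α → ℕ → R)
    (LL : List (List α)) (S : Finset ℕ) : R :=
  ∑ K ∈ Finset.powersetCard LL.length S,
    ((LL.zip (K.sort (· ≤ ·))).map (fun Bk => w Bk.1 Bk.2)).prod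

section ChainSum

variable {α : Type} {R : Type*} [CommRing R] (w : List α → ℕ → R)

lemma chainSum_nil (S : Finset ℕ) : chainSum w [] S = 1 := by
  simp [chainSum]

lemma chainSum_cons_empty (B : List α) (LL : List (List α)) :
    chainSum w (B :: LL) ∅ = 0 := by
  rw [chainSum, Finset.powersetCard_eq_empty.mpr (by simp), Finset.sum_empty]

lemma chainSum_cons_insert (B : List α) (LL : List (List α)) {a : ℕ} {S : Finset ℕ}
    (ha : ∀ b ∈ S, a < b) :
    chainSum w (B :: LL) (insert a S) =
      chainSum w (B :: LL) S + w B a * chainSum w LL S := by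
  have haS : a ∉ S := fun h => lt_irrefl a (ha a h)
  have hK : ∀ {n : ℕ} {K : Finset ℕ}, K ∈ Finset.powersetCard n S → K ⊆ S :=
    fun h => (Finset.mem_powersetCard.mp h).1
  unfold chainSum
  rw [List.length_cons, Finset.powersetCard_succ_insert haS, Finset.sum_union]
  · congr 1
    rw [Finset.sum_image, Finset.mul_sum]
    · refine Finset.sum_congr rfl fun K hKm => ?_
      rw [Finset.sort_insert (r := (· ≤ ·)) (fun b hb => (ha b (hK hKm hb)).le)
        (fun h => haS (hK hKm h))]
      simp
    · intro K₁ h₁ K₂ h₂ h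
      have e₁ := Finset.erase_insert (fun h => haS (hK h₁ h))
      have e₂ := Finset.erase_insert (fun h => haS (hK h₂ h))
      rw [← e₁, ← e₂]
      exact congrArg (fun K => Finset.erase K a) h
  · rw [Finset.disjoint_left]
    intro K h₁ h₂
    obtain ⟨K', -, rfl⟩ := Finset.mem_image.mp h₂
    exact haS (hK h₁ (Finset.mem_insert_self a K'))

/-- A sum over all block decompositions of a nonempty list, arranged by the first block. -/
lemma sum_splits_cons_s11 (f : List (List α) → R) (a : α) (l : List α) :
    ((splits (a :: l)).map f).sum =
      ∑ j ∈ Finset.range (l.length + 1),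
        ((splits (l.drop j)).map (fun LL => f ((a :: l.take j) :: LL))).sum := by
  induction l generalizing a f with
  | nil => simp [splits]
  | cons b l ih =>
    have key : ((splits (a :: b :: l)).map f).sum =
        ((splits (b :: l)).map (fun LL => f ([a] :: LL))).sum +
        ((splits (b :: l)).map (fun LL =>
          match LL with
          | [] => 0
          | B :: rest => f ((a :: B) :: rest))).sum := by
      have hne : ∀ LL ∈ splits (b :: l), LL ≠ [] := by
        intro LL hLL
        simp only [splits, List.mem_flatMap] at hLL
        obtain ⟨LL', -, h⟩ := hLL
        rcases LL' with _ | ⟨B, rest⟩ <;> simp at h <;> aesop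
      rw [splits]
      generalize splits (b :: l) = s at hne
      induction s with
      | nil => simp
      | cons LL s ihs =>
        have h1 := ihs (fun LL h => hne LL (List.mem_cons_of_mem _ h))
        rcases LL with _ | ⟨B, rest⟩
        · exact absurd rfl (hne [] List.mem_cons_self)
        · simp only [List.flatMap_cons, List.map_append, List.sum_append, List.map_cons,
            List.sum_cons, List.map_nil, List.sum_nil, h1]
          ring
    rw [key, List.length_cons, Finset.sum_range_succ' _ (l.length + 1), add_comm]
    congr 1
    exact ih _ b

/-- The sum of `chainSum` over all block decompositions of `L`. -/
noncomputable def splitSum (L : List α) (S : Finset ℕ) : R :=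
  ((splits L).map (fun LL => chainSum w LL S)).sum

lemma splitSum_nil (S : Finset ℕ) : splitSum w [] S = 1 := by
  simp [splitSum, splits, chainSum_nil]

lemma splitSum_cons_empty (a : α) (l : List α) : splitSum w (a :: l) ∅ = 0 := by
  simp [splitSum, sum_splits_cons_s11, chainSum_cons_empty]

lemma splitSum_cons_insert (b : α) (l : List α) {a : ℕ} {S : Finset ℕ}
    (ha : ∀ b ∈ S, a < b) :
    splitSum w (b :: l) (insert a S) = splitSum w (b :: l) S +
      ∑ j ∈ Finset.range (l.length + 1), w (b :: l.take j) a * splitSum w (l.drop j) S := by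
  simp only [splitSum, sum_splits_cons_s11, chainSum_cons_insert w _ _ ha, List.sum_map_add,
    List.sum_map_mul_left, Finset.sum_add_distrib]

end ChainSum

/-- The divided power `x ^ n / n!`. -/
noncomputable def dividedPow (n : ℕ) (x : PQPoly) : PQPoly := C ((n.factorial : ℂ))⁻¹ * x ^ n

lemma dividedPow_add (n : ℕ) (x y : PQPoly) :
    dividedPow n (x + y) =
      ∑ j ∈ Finset.range (n + 1), dividedPow j x * dividedPow (n - j) y := by
  unfold dividedPow
  rw [add_pow, Finset.mul_sum]
  refine Finset.sum_congr rfl fun j hj => ?_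
  have hjn : j ≤ n := Nat.lt_succ_iff.mp (Finset.mem_range.mp hj)
  have h : ((n.factorial : ℂ))⁻¹ * (n.choose j : ℂ) =
      ((j.factorial : ℂ))⁻¹ * (((n - j).factorial : ℂ))⁻¹ := by
    have h1 : (n.factorial : ℂ) ≠ 0 := by exact_mod_cast n.factorial_ne_zero
    have h2 : (j.factorial : ℂ) ≠ 0 := by exact_mod_cast j.factorial_ne_zero
    have h3 : ((n - j).factorial : ℂ) ≠ 0 := by exact_mod_cast (n - j).factorial_ne_zero
    rw [Nat.cast_choose ℂ hjn]
    field_simp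
  have h' := congrArg (C (σ := ℕ ⊕ ℕ)) h
  simp only [map_mul, map_natCast] at h'
  linear_combination x ^ j * y ^ (n - j) * h'

lemma dividedPow_zero_left (x : PQPoly) : dividedPow 0 x = 1 := by
  simp [dividedPow]

/-- `H_{(1^r, c+1)}` restricted to the indices in `[a, a+n)`. -/
lemma splitSum_ones (m c n : ℕ) : ∀ a r : ℕ,
    splitSum (Hterm m) (List.replicate r 1 ++ [c + 1]) (Finset.Ico a (a + n)) =
      ∑ i ∈ Finset.Ico a (a + n), qprime m i ^ c *
        (dividedPow (r + 1) (∑ k ∈ Finset.Ico a (i + 1), X (Sum.inl k)) -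
          dividedPow (r + 1) (∑ k ∈ Finset.Ico a i, X (Sum.inl k))) := by
  induction n with
  | zero =>
    intro a r
    cases r <;> simp [List.replicate_succ, splitSum_cons_empty]
  | succ n ih =>
    intro a r
    have hIco : Finset.Ico a (a + (n + 1)) = insert a (Finset.Ico (a + 1) (a + 1 + n)) := by
      rw [show a + (n + 1) = a + 1 + n by omega, Finset.insert_Ico_add_one_left_eq_Ico (by omega)]
    have hlt : ∀ b ∈ Finset.Ico (a + 1) (a + 1 + n), a < b := fun b hb => by
      have := Finset.mem_Ico.mp hb
      omega
    have hpeel : splitSum (Hterm m) (List.replicate r 1 ++ [c + 1])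
          (insert a (Finset.Ico (a + 1) (a + 1 + n))) =
        ∑ j ∈ Finset.range (r + 1), dividedPow j (X (Sum.inl a)) *
            splitSum (Hterm m) (List.replicate (r - j) 1 ++ [c + 1])
              (Finset.Ico (a + 1) (a + 1 + n)) +
          dividedPow (r + 1) (X (Sum.inl a)) * qprime m a ^ c := by
      rw [Finset.sum_range_succ', dividedPow_zero_left, one_mul, Nat.sub_zero]
      rcases r with _ | r
      · simp [splitSum_cons_insert _ _ _ hlt, splitSum_nil, Hterm, dividedPow]
      · rw [List.replicate_succ, List.cons_append, splitSum_cons_insert _ _ _ hlt]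
        simp only [List.length_append, List.length_replicate, List.length_singleton]
        rw [Finset.sum_range_succ _ (r + 1)]
        have hw : Hterm m (1 :: (List.replicate r 1 ++ [c + 1]).take (r + 1)) a =
            dividedPow (r + 1 + 1) (X (Sum.inl a)) * qprime m a ^ c := by
          rw [List.take_of_length_le (by simp)]
          simp only [Hterm, dividedPow, List.length_cons, List.length_append,
            List.length_replicate, List.length_nil, List.sum_cons, List.sum_append,
            List.sum_replicate, List.sum_nil, smul_eq_mul]
          congr 2
          omega
        rw [hw, List.drop_of_length_le (by simp), splitSum_nil]
        have hs : ∀ j ∈ Finset.range (r + 1),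
            Hterm m (1 :: (List.replicate r 1 ++ [c + 1]).take j) a *
              splitSum (Hterm m) ((List.replicate r 1 ++ [c + 1]).drop j)
                (Finset.Ico (a + 1) (a + 1 + n)) =
            dividedPow (j + 1) (X (Sum.inl a)) *
              splitSum (Hterm m) (List.replicate (r + 1 - (j + 1)) 1 ++ [c + 1])
                (Finset.Ico (a + 1) (a + 1 + n)) := by
          intro j hj
          have hjr : j ≤ r := Nat.lt_succ_iff.mp (Finset.mem_range.mp hj)
          rw [List.take_append_of_le_length (by simpa), List.drop_append_of_le_length (by simpa),
            List.take_replicate, List.drop_replicate, min_eq_left hjr,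
            show r + 1 - (j + 1) = r - j by omega]
          simp [Hterm, dividedPow, add_comm]
        rw [Finset.sum_congr rfl hs]
        ring
    rw [hIco, hpeel, Finset.sum_insert (by simp)]
    simp only [ih]
    rw [add_comm]
    congr 1
    · simp [dividedPow]
      ring
    · simp only [Finset.mul_sum]
      rw [Finset.sum_comm]
      refine Finset.sum_congr rfl fun i hi => ?_
      have hai : a < i := hlt i hi
      rw [Finset.sum_eq_sum_Ico_succ_bot (show a < i + 1 by omega),
        Finset.sum_eq_sum_Ico_succ_bot hai, dividedPow_add, dividedPow_add,
        Finset.sum_range_succ _ (r + 1), Finset.sum_range_succ _ (r + 1), Nat.sub_self,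
        dividedPow_zero_left, dividedPow_zero_left, add_sub_add_right_eq_sub,
        ← Finset.sum_sub_distrib, Finset.mul_sum]
      refine Finset.sum_congr rfl fun j hj => ?_
      rw [show r + 1 - j = r - j + 1 by have := Finset.mem_range.mp hj; omega]
      ring

lemma HI_ones (m c r : ℕ) :
    HI (List.replicate r 1 ++ [c + 1]) m =
      ∑ i ∈ Finset.range m, qprime m i ^ c *
        (dividedPow (r + 1) (∑ k ∈ Finset.range (i + 1), X (Sum.inl k)) -
          dividedPow (r + 1) (∑ k ∈ Finset.range i, X (Sum.inl k))) := by
  have h := splitSum_ones m c m 0 r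
  simp only [zero_add, ← Finset.range_eq_Ico] at h
  exact h

lemma xExpr_even (m i : ℕ) :
    xExpr m (2 * i) = qprime m i - ∑ k ∈ Finset.range i, X (Sum.inl k) := by
  have h1 : (2 * i + 1) / 2 = i := by omega
  simp [xExpr, qprime, h1]

lemma xExpr_odd (m i : ℕ) :
    xExpr m (2 * i + 1) = qprime m i - ∑ k ∈ Finset.range (i + 1), X (Sum.inl k) := by
  have h1 : (2 * i + 1 + 1) / 2 = i + 1 := by omega
  simp [xExpr, qprime, h1]

lemma sum_range_two_mul {M : Type*} [AddCommMonoid M] (f : ℕ → M) (m : ℕ) :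
    ∑ t ∈ Finset.range (2 * m), f t = ∑ i ∈ Finset.range m, (f (2 * i) + f (2 * i + 1)) := by
  induction m with
  | zero => simp
  | succ m ih =>
    rw [show 2 * (m + 1) = 2 * m + 1 + 1 by ring, Finset.sum_range_succ, Finset.sum_range_succ,
      ih, Finset.sum_range_succ, add_assoc]

lemma phi_MkX_apply (k m : ℕ) :
    PhiXtoPQ (MkX k) m =
      ∑ i ∈ Finset.range m,
        ((qprime m i - ∑ j ∈ Finset.range (i + 1), X (Sum.inl j)) ^ k -
          (qprime m i - ∑ j ∈ Finset.range i, X (Sum.inl j)) ^ k) -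
        (-∑ j ∈ Finset.range m, X (Sum.inl j)) ^ k := by
  have hq : qprime m m = 0 := by simp [qprime]
  simp only [PhiXtoPQ, MkX, map_sum, map_smul, map_pow, aeval_X]
  rw [Finset.sum_range_succ, sum_range_two_mul]
  have hodd : ∀ i : ℕ, (-1 : ℂ) ^ (2 * i + 1) = -1 := fun i => (odd_two_mul_add_one i).neg_one_pow
  have heven : ∀ i : ℕ, (-1 : ℂ) ^ (2 * i + 1 + 1) = 1 := fun i => by rw [pow_succ, hodd]; norm_num
  simp only [xExpr_even, xExpr_odd, hq, hodd, heven, zero_sub, neg_smul, one_smul,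
    neg_add_eq_sub, ← sub_eq_add_neg]

/-- The binomial expansion of `(q - P)^k`, without its extreme terms. -/
lemma sub_pow_eq_sum_dividedPow (k : ℕ) (hk : 1 ≤ k) (q P : PQPoly) :
    (q - P) ^ k = q ^ k + (-P) ^ k + ∑ i ∈ Finset.range (k - 1),
      (((-1 : ℂ)) ^ (i + 1) * (Nat.descFactorial k (i + 1) : ℂ)) •
        (q ^ (k - i - 1) * dividedPow (i + 1) P) := by
  obtain ⟨k, rfl⟩ := Nat.exists_eq_add_of_le' hk
  rw [sub_eq_neg_add, add_pow, Finset.sum_range_succ, Finset.sum_range_succ']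
  have h : ∀ i ∈ Finset.range k,
      (-P) ^ (i + 1) * q ^ (k + 1 - (i + 1)) * ((k + 1).choose (i + 1) : PQPoly) =
      (((-1 : ℂ)) ^ (i + 1) * (Nat.descFactorial (k + 1) (i + 1) : ℂ)) •
        (q ^ (k + 1 - i - 1) * dividedPow (i + 1) P) := by
    intro i _
    have hf : ((i + 1).factorial : ℂ) ≠ 0 := by exact_mod_cast (i + 1).factorial_ne_zero
    have hc : (C ((i + 1).factorial : ℂ) : PQPoly) * C (((i + 1).factorial : ℂ))⁻¹ = 1 := by
      rw [← map_mul, mul_inv_cancel₀ hf, map_one]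
    rw [Nat.descFactorial_eq_factorial_mul_choose, smul_eq_C_mul, dividedPow, neg_pow,
      show k + 1 - (i + 1) = k + 1 - i - 1 by omega]
    push_cast [map_mul, map_pow, map_neg, map_one]
    rw [map_natCast] at hc ⊢
    rw [map_natCast]
    linear_combination (-(-1) ^ (i + 1) * P ^ (i + 1) * q ^ (k + 1 - i - 1) *
      ((k + 1).choose (i + 1) : PQPoly)) * hc
  rw [Finset.sum_congr rfl h]
  simp
  ring

/-- For `k ≥ 2`,
`Φ_{x→p,q}(M_k(𝕏)) = ∑_{i=0}^{k-2} (-1)^{i+1} k(k-1)⋯(k-i) · H_{(1^i, k-i)}`. -/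
theorem phi_Mk_H_expansion (k : ℕ) (hk : 2 ≤ k) :
    PhiXtoPQ (MkX k) =
      ∑ i ∈ Finset.range (k - 1),
        (((-1 : ℂ)) ^ (i + 1) * (Nat.descFactorial k (i + 1) : ℂ)) •
          HI (List.replicate i 1 ++ [k - i]) := by
  funext m
  have hH : ∀ i ∈ Finset.range (k - 1),
      HI (List.replicate i 1 ++ [k - i]) m =
      ∑ j ∈ Finset.range m, qprime m j ^ (k - i - 1) *
        (dividedPow (i + 1) (∑ l ∈ Finset.range (j + 1), X (Sum.inl l)) -
          dividedPow (i + 1) (∑ l ∈ Finset.range j, X (Sum.inl l))) := by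
    intro i hi
    rw [← HI_ones, Nat.sub_add_cancel (by have := Finset.mem_range.mp hi; omega)]
  have htel := Finset.sum_range_sub
    (fun i => (-∑ l ∈ Finset.range i, X (Sum.inl l) : PQPoly) ^ k) m
  simp only [Finset.range_zero, Finset.sum_empty, neg_zero, zero_pow (show k ≠ 0 by omega),
    sub_zero] at htel
  rw [phi_MkX_apply, ← htel, ← Finset.sum_sub_distrib, Finset.sum_apply]
  simp only [Pi.smul_apply]
  rw [Finset.sum_congr rfl fun i hi => congrArg _ (hH i hi)]
  simp only [Finset.smul_sum]
  rw [Finset.sum_comm]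
  refine Finset.sum_congr rfl fun j _ => ?_
  simp only [mul_sub, smul_sub, Finset.sum_sub_distrib]
  rw [sub_pow_eq_sum_dividedPow k (by omega), sub_pow_eq_sum_dividedPow k (by omega)]
  ring
end

section
/- Let V = V_1 ⊔ V_2 be a finite set and E_{1,2}, E_{2,1} ⊆ V_1 × V_2 two sets of edges such that every element of V is an endpoint of at least one edge of E_{1,2}. Define, for each m ≥ 0, (N_G)_m = Σ_r Π_{v ∈ V_1} p_{r(v)} Π_{v ∈ V_2} q_{r(v)}, where the sum runs over all maps r: V → {1,…,m} satisfying r(v_1) ≤ r(v_2) for every (v_1,v_2) ∈ E_{1,2} and r(v_2) < r(v_1) for every (v_1,v_2) ∈ E_{2,1}. Then N_G = ((N_G)_m)_{m≥0} is a two-alphabet stable polynomial belonging to Sol′. -/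
open MvPolynomial

/-- The space `Sol'` of solutions of the multirectangular system, as a `ℂ`-vector space. -/
noncomputable def SolPQSub : Submodule ℂ PQSeq where
  carrier := {h | IsSolPQ h}
  zero_mem' := by
    refine ⟨⟨fun m => Subalgebra.zero_mem _, fun m => by simp only [Pi.zero_apply, map_zero]⟩,
      fun m j _ => by simp only [Pi.zero_apply, map_zero],
      fun m _ => by simp only [Pi.zero_apply, map_zero],
      fun m j _ _ => by simp only [Pi.zero_apply, map_zero],
      fun m _ => by simp only [Pi.zero_apply, map_zero]⟩
  add_mem' := by
    rintro a b ⟨⟨ha1, ha2⟩, ha3, ha4, ha5, ha6⟩ ⟨⟨hb1, hb2⟩, hb3, hb4, hb5, hb6⟩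
    exact ⟨⟨fun m => Subalgebra.add_mem _ (ha1 m) (hb1 m),
        fun m => by simp only [Pi.add_apply, map_add, ha2 m, hb2 m]⟩,
      fun m j hj => by simp only [Pi.add_apply, map_add, ha3 m j hj, hb3 m j hj],
      fun m hm => by simp only [Pi.add_apply, map_add, ha4 m hm, hb4 m hm],
      fun m j hj hjm => by simp only [Pi.add_apply, map_add, ha5 m j hj hjm, hb5 m j hj hjm],
      fun m hm => by simp only [Pi.add_apply, map_add, ha6 m hm, hb6 m hm]⟩
  smul_mem' := by
    rintro c a ⟨⟨ha1, ha2⟩, ha3, ha4, ha5, ha6⟩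
    exact ⟨⟨fun m => Subalgebra.smul_mem _ (ha1 m) c,
        fun m => by simp only [Pi.smul_apply, map_smul, ha2 m]⟩,
      fun m j hj => by simp only [Pi.smul_apply, map_smul, ha3 m j hj],
      fun m hm => by simp only [Pi.smul_apply, map_smul, ha4 m hm],
      fun m j hj hjm => by simp only [Pi.smul_apply, map_smul, ha5 m j hj hjm],
      fun m hm => by simp only [Pi.smul_apply, map_smul, ha6 m hm]⟩

/-- The polynomial `N_G` attached to a bipartite graph `G` with vertex set `V₁ ⊔ V₂` and two
sets of edges `E₁₂, E₂₁ ⊆ V₁ × V₂`: its `m`-th component is the sum, over all maps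
`r : V₁ ⊔ V₂ → {1, …, m}` satisfying the order condition (`r v₁ ≤ r v₂` for `(v₁,v₂) ∈ E₁₂`
and `r v₂ < r v₁` for `(v₁,v₂) ∈ E₂₁`), of `∏_{v ∈ V₁} p_{r v} · ∏_{v ∈ V₂} q_{r v}`. -/
noncomputable def NG (V1 V2 : Type) [Fintype V1] [Fintype V2] [DecidableEq V1] [DecidableEq V2]
    (E12 E21 : Finset (V1 × V2)) : PQSeq :=
  fun m =>
    ∑ r ∈ (Finset.univ : Finset (V1 ⊕ V2 → Fin m)).filter
        (fun r => (∀ e ∈ E12, r (Sum.inl e.1) ≤ r (Sum.inr e.2)) ∧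
          (∀ e ∈ E21, r (Sum.inr e.2) < r (Sum.inl e.1))),
      (∏ v : V1, X (Sum.inl ((r (Sum.inl v) : ℕ)))) *
        ∏ v : V2, X (Sum.inr ((r (Sum.inr v) : ℕ)))

/-- The variable `p_k` or `q_k` contributed by a vertex sent to `k`. -/
def vertexVar {V1 V2 : Type} (v : V1 ⊕ V2) (k : ℕ) : ℕ ⊕ ℕ :=
  Sum.map (fun _ => k) (fun _ => k) v

/-- The order condition on `r` imposed by the two sets of edges. -/
def OrderCond {V1 V2 : Type} (E12 E21 : Finset (V1 × V2)) (r : V1 ⊕ V2 → ℕ) : Prop :=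
  (∀ e ∈ E12, r (Sum.inl e.1) ≤ r (Sum.inr e.2)) ∧
    ∀ e ∈ E21, r (Sum.inr e.2) < r (Sum.inl e.1)

/-- Identifying the values `i` and `i + 1` preserves the order condition on maps which do not take
the value `i` on `V₂`, or do not take the value `i + 1` on `V₁`. -/
lemma orderCond_collapse {V1 V2 : Type} {E12 E21 : Finset (V1 × V2)} {r : V1 ⊕ V2 → ℕ} {i : ℕ}
    (h : (∀ v2, r (Sum.inr v2) ≠ i) ∨ ∀ v1, r (Sum.inl v1) ≠ i + 1) :
    OrderCond E12 E21 r ↔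
      OrderCond E12 E21 (fun v => if r v ≤ i then r v else r v - 1) := by
  have key : ∀ v1 v2, ¬ (r (Sum.inl v1) = i + 1 ∧ r (Sum.inr v2) = i) := by grind
  refine and_congr (forall₂_congr fun e _ => ?_) (forall₂_congr fun e _ => ?_) <;>
  have := key e.1 e.2 <;> grind

lemma filter_range_collapse {m i k : ℕ} (hi : i + 1 ≤ m) (hk : k < m) :
    {l ∈ Finset.range (m + 1) | (if l ≤ i then l else l - 1) = k} =
      if k < i then {k} else if k = i then {i, i + 1} else {k + 1} := by
  grind

section WeightedSum

variable {V : Type} [Fintype V] [DecidableEq V]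

open Classical in
/-- The sum over all maps `r : V → {0, …, m - 1}` satisfying `P` of the products of the weights
`f v (r v)`. -/
noncomputable def weightedSum (P : (V → ℕ) → Prop) (m : ℕ) (f : V → ℕ → PQPoly) : PQPoly :=
  ∑ r ∈ (Fintype.piFinset fun _ : V => Finset.range m) with P r, ∏ v, f v (r v)

/-- Relabelling the values along `c` does not change a weighted sum, provided that the weights are
summed over the fibres of `c` and that `c` preserves the condition on all maps of nonzero weight. -/
lemma weightedSum_eq_of_fiber {P : (V → ℕ) → Prop} {m n : ℕ} {f g : V → ℕ → PQPoly} (c : ℕ → ℕ)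
    (hg : ∀ v, ∀ k < n, g v k = ∑ l ∈ Finset.range m with c l = k, f v l)
    (hP : ∀ r : V → ℕ, (∀ v, r v < m) → (∀ v, f v (r v) ≠ 0) →
      (P r ↔ (∀ v, c (r v) < n) ∧ P (fun v => c (r v)))) :
    weightedSum P m f = weightedSum P n g := by
  classical
  unfold weightedSum
  have expand : ∀ s ∈ {s ∈ Fintype.piFinset fun _ : V => Finset.range n | P s},
      ∏ v, g v (s v) =
        ∑ r ∈ (Fintype.piFinset fun _ : V => Finset.range m) with (fun v => c (r v)) = s,
          ∏ v, f v (r v) := by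
    intro s hs
    simp only [Finset.mem_filter, Fintype.mem_piFinset, Finset.mem_range] at hs
    rw [Finset.prod_congr rfl fun v _ => hg v (s v) (hs.1 v), Finset.prod_univ_sum]
    refine Finset.sum_congr ?_ fun _ _ => rfl
    ext r
    simp only [Fintype.mem_piFinset, Finset.mem_filter, Finset.mem_range, funext_iff]
    exact forall_and
  rw [Finset.sum_congr rfl expand, Finset.sum_fiberwise_eq_sum_filter, Finset.sum_filter,
    Finset.sum_filter]
  refine Finset.sum_congr rfl fun r hr => ?_
  simp only [Fintype.mem_piFinset, Finset.mem_range] at hr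
  by_cases h0 : ∀ v, f v (r v) ≠ 0
  · simp only [Finset.mem_filter, Fintype.mem_piFinset, Finset.mem_range, hP r hr h0]
  · push Not at h0
    obtain ⟨v, hv⟩ := h0
    rw [Finset.prod_eq_zero (Finset.mem_univ v) hv, ite_self, ite_self]

end WeightedSum

section NG

variable {V1 V2 : Type} [Fintype V1] [Fintype V2] [DecidableEq V1] [DecidableEq V2]
  {E12 E21 : Finset (V1 × V2)}

lemma aeval_NG (m : ℕ) (w : ℕ ⊕ ℕ → PQPoly) :
    aeval w (NG V1 V2 E12 E21 m) =
      weightedSum (OrderCond E12 E21) m (fun v k => w (vertexVar v k)) := by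
  classical
  simp only [NG, weightedSum, map_sum, map_mul, map_prod, aeval_X]
  refine Finset.sum_bij (fun r _ v => (r v : ℕ)) ?_ ?_ ?_ ?_
  · intro r hr
    simpa [OrderCond] using hr
  · intro r _ s _ h
    funext v
    exact Fin.ext (congrFun h v)
  · intro r hr
    simp only [Finset.mem_filter, Fintype.mem_piFinset, Finset.mem_range] at hr
    exact ⟨fun v => ⟨r v, hr.1 v⟩, by simpa [OrderCond] using hr.2, rfl⟩
  · intro r _
    simp [Fintype.prod_sum_type, vertexVar]

lemma NG_eq_weightedSum (m : ℕ) :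
    NG V1 V2 E12 E21 m =
      weightedSum (OrderCond E12 E21) m (fun v k => X (vertexVar v k)) := by
  rw [← aeval_NG, aeval_X_left_apply]

lemma NG_mem_supported (m : ℕ) : NG V1 V2 E12 E21 m ∈ supported ℂ (pqVars m) := by
  refine sum_mem fun r _ => mul_mem (prod_mem fun v _ => ?_) (prod_mem fun v _ => ?_) <;>
  simp [X_mem_supported, pqVars]

lemma killPQ_NG (m : ℕ) : killPQ m (NG V1 V2 E12 E21 (m + 1)) = NG V1 V2 E12 E21 m := by
  rw [killPQ, aeval_NG, NG_eq_weightedSum]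
  refine weightedSum_eq_of_fiber id ?_ ?_
  · rintro (v | v) k hk <;>
    simp [vertexVar, hk.ne, show k < m + 1 by omega]
  · intro r hr h0
    refine (and_iff_right fun v => ?_).symm
    have h := h0 v
    have := hr v
    rcases v with v | v <;> simp [vertexVar] at h <;> grind

lemma subst0PQ_inr_last_NG (h1 : ∀ v1 : V1, ∃ v2, (v1, v2) ∈ E12) (m : ℕ) :
    subst0PQ (Sum.inr m) (NG V1 V2 E12 E21 (m + 1)) = NG V1 V2 E12 E21 m := by
  rw [subst0PQ, aeval_NG, NG_eq_weightedSum]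
  refine weightedSum_eq_of_fiber id ?_ ?_
  · rintro (v | v) k hk <;>
    simp [vertexVar, hk.ne, show k < m + 1 by omega]
  · intro r hr h0
    refine ⟨fun hc => ⟨?_, hc⟩, fun h => h.2⟩
    have hq : ∀ v2, r (Sum.inr v2) < m := fun v2 => by
      have h := h0 (Sum.inr v2)
      have := hr (Sum.inr v2)
      simp [vertexVar] at h
      omega
    rintro (v | v)
    · obtain ⟨v2, hv⟩ := h1 v
      exact (hc.1 _ hv).trans_lt (hq v2)
    · exact hq v

lemma subst0PQ_inl_zero_NG (h2 : ∀ v2 : V2, ∃ v1, (v1, v2) ∈ E12) (m : ℕ) :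
    subst0PQ (Sum.inl 0) (NG V1 V2 E12 E21 (m + 1)) = shiftPQ (NG V1 V2 E12 E21 m) := by
  rw [subst0PQ, shiftPQ, aeval_NG, aeval_NG]
  refine weightedSum_eq_of_fiber (fun k => if k = 0 then m else k - 1) ?_ ?_
  · intro v k hk
    have hfib : {l ∈ Finset.range (m + 1) | (if l = 0 then m else l - 1) = k} = {k + 1} := by
      grind
    rw [hfib]
    rcases v with v | v <;> simp [vertexVar]
  · intro r hr h0
    have hp : ∀ v1, r (Sum.inl v1) ≠ 0 := fun v1 => by
      simpa [vertexVar] using h0 (Sum.inl v1)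
    constructor
    · intro hc
      have hpos : ∀ v, r v ≠ 0 := by
        rintro (v | v)
        · exact hp v
        · obtain ⟨v1, hv⟩ := h2 v
          have := hc.1 _ hv
          have := hp v1
          grind
      refine ⟨fun v => by grind, fun e he => ?_, fun e he => ?_⟩
      · have := hc.1 e he
        grind
      · have := hc.2 e he
        grind
    · rintro ⟨hlt, hc⟩
      have hpos : ∀ v, r v ≠ 0 := fun v => by
        have := hlt v
        grind
      refine ⟨fun e he => ?_, fun e he => ?_⟩
      · have := hc.1 e he
        grind
      · have := hc.2 e he
        grind

lemma subst0PQ_inr_NG {m j : ℕ} (hj : j + 1 ≤ m) :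
    subst0PQ (Sum.inr j) (NG V1 V2 E12 E21 (m + 1)) = mergeP j (NG V1 V2 E12 E21 m) := by
  rw [subst0PQ, mergeP, aeval_NG, aeval_NG]
  refine weightedSum_eq_of_fiber (fun k => if k ≤ j then k else k - 1) ?_ ?_
  · intro v k hk
    rw [filter_range_collapse hj hk]
    rcases lt_trichotomy k j with h | h | h
    · rcases v with v | v <;> simp [vertexVar, h, h.ne]
    · rcases v with v | v <;> simp [vertexVar, h]
    · rcases v with v | v <;> simp [vertexVar, h.not_gt, h.ne', show k + 1 ≠ j by omega]
  · intro r hr h0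
    rw [← orderCond_collapse (Or.inl fun v2 => by
      simpa [vertexVar] using h0 (Sum.inr v2))]
    exact (and_iff_right fun v => by grind).symm

lemma subst0PQ_inl_NG {m j : ℕ} (hj : j + 1 ≤ m) :
    subst0PQ (Sum.inl (j + 1)) (NG V1 V2 E12 E21 (m + 1)) =
      mergeQ (j + 1) (NG V1 V2 E12 E21 m) := by
  rw [subst0PQ, mergeQ, aeval_NG, aeval_NG]
  refine weightedSum_eq_of_fiber (fun k => if k ≤ j then k else k - 1) ?_ ?_
  · intro v k hk
    rw [filter_range_collapse hj hk]
    rcases lt_trichotomy k j with h | h | h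
    · rcases v with v | v <;>
      simp [vertexVar, h, h.le, show k ≠ j + 1 by omega]
    · rcases v with v | v <;> simp [vertexVar, h]
    · rcases v with v | v <;>
      simp [vertexVar, h, h.not_gt, h.ne']
  · intro r hr h0
    rw [← orderCond_collapse (Or.inr fun v1 => by
      simpa [vertexVar] using h0 (Sum.inl v1))]
    exact (and_iff_right fun v => by grind).symm

end NG

/-- If every vertex of the bipartite graph `G` is an endpoint of at least one
edge of `E₁₂`, then `N_G` is a two-alphabet stable polynomial belonging to `Sol'`. -/
theorem NG_mem_solPQ (V1 V2 : Type) [Fintype V1] [Fintype V2] [DecidableEq V1] [DecidableEq V2]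
    (E12 E21 : Finset (V1 × V2))
    (h1 : ∀ v1 : V1, ∃ v2, (v1, v2) ∈ E12)
    (h2 : ∀ v2 : V2, ∃ v1, (v1, v2) ∈ E12) :
    NG V1 V2 E12 E21 ∈ SolPQSub := by
  refine ⟨⟨NG_mem_supported, killPQ_NG⟩, fun m j hj => ?_, fun m hm => ?_, fun m j hj hjm => ?_,
    fun m hm => ?_⟩
  · obtain ⟨m, rfl⟩ := Nat.exists_eq_add_of_le' (show 1 ≤ m by omega)
    exact subst0PQ_inr_NG (by omega)
  · obtain ⟨m, rfl⟩ := Nat.exists_eq_add_of_le' hm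
    exact subst0PQ_inr_last_NG h1 m
  · obtain ⟨m, rfl⟩ := Nat.exists_eq_add_of_le' (show 1 ≤ m by omega)
    obtain ⟨j, rfl⟩ := Nat.exists_eq_add_of_le' hj
    exact subst0PQ_inl_NG (by omega)
  · obtain ⟨m, rfl⟩ := Nat.exists_eq_add_of_le' hm
    exact subst0PQ_inl_zero_NG h2 m
end
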